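/- arXiv:1808.02697 — 4 statements merged into one kernel-verified Lean document; each statement's English description precedes it below -/
import Mathlib

section
/- Let η be an integer and let f : U → ℂ be a smooth function on the open set U = {(θ,φ) ∈ ℝ² : 0 < θ < π}. Then the spin-weight raising and lowering operators satisfy the commutation identity ð̄_{η+1}(ð_η f) − ð_{η−1}(ð̄_η f) = 2η·f pointwise on U (i.e., the commutator [ð̄, ð] acts as multiplication by 2η on functions of spin weight η). -/
open Complex

/-- The open coordinate domain `U = {(θ,φ) : 0 < θ < π}`. -/
def sphDomain : Set (ℝ × ℝ) := {p | 0 < p.1 ∧ p.1 < Real.pi}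

/-- Partial derivative in the first (θ) variable. -/
noncomputable def pdTheta (f : ℝ × ℝ → ℂ) : ℝ × ℝ → ℂ :=
  fun p => deriv (fun t => f (t, p.2)) p.1

/-- Partial derivative in the second (φ) variable. -/
noncomputable def pdPhi (f : ℝ × ℝ → ℂ) : ℝ × ℝ → ℂ :=
  fun p => deriv (fun t => f (p.1, t)) p.2

/-- The spin-weight raising operator `ð_η`. -/
noncomputable def eth (η : ℤ) (f : ℝ × ℝ → ℂ) : ℝ × ℝ → ℂ :=
  fun p =>
    -((Real.sin p.1 : ℂ) ^ η) *
      (pdTheta (fun q => ((Real.sin q.1 : ℂ) ^ (-η)) * f q) p +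
        (Complex.I / (Real.sin p.1 : ℂ)) *
          pdPhi (fun q => ((Real.sin q.1 : ℂ) ^ (-η)) * f q) p)

/-- The spin-weight lowering operator `ð̄_η`. -/
noncomputable def ethBar (η : ℤ) (f : ℝ × ℝ → ℂ) : ℝ × ℝ → ℂ :=
  fun p =>
    -((Real.sin p.1 : ℂ) ^ (-η)) *
      (pdTheta (fun q => ((Real.sin q.1 : ℂ) ^ η) * f q) p -
        (Complex.I / (Real.sin p.1 : ℂ)) *
          pdPhi (fun q => ((Real.sin q.1 : ℂ) ^ η) * f q) p)

lemma aux_zpow (n : ℤ) (x : ℝ) (hs : (Real.sin x : ℂ) ≠ 0) :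
    HasDerivAt (fun t : ℝ => ((Real.sin t : ℂ) ^ n))
      ((n : ℂ) * (Real.sin x : ℂ) ^ (n - 1) * (Real.cos x : ℂ)) x := by
  have h1 : HasDerivAt (fun t : ℝ => (Real.sin t : ℂ)) (Real.cos x : ℂ) x :=
    (Real.hasDerivAt_sin x).ofReal_comp
  exact (hasDerivAt_zpow n (Real.sin x : ℂ) (Or.inl hs)).comp x h1

lemma aux_eth (n : ℤ) (g : ℝ × ℝ → ℂ) (p : ℝ × ℝ) (a b : ℂ)
    (hs : (Real.sin p.1 : ℂ) ≠ 0)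
    (ha : HasDerivAt (fun t => g (t, p.2)) a p.1)
    (hb : HasDerivAt (fun t => g (p.1, t)) b p.2) :
    eth n g p = -(a + I / (Real.sin p.1 : ℂ) * b
      - n * (Real.cos p.1 : ℂ) / (Real.sin p.1 : ℂ) * g p) := by
  have h1 := ((aux_zpow (-n) p.1 hs).mul ha).deriv
  have h2 := (hb.const_mul ((Real.sin p.1 : ℂ) ^ (-n))).deriv
  unfold eth pdTheta pdPhi
  simp only [Pi.mul_def] at h1
  simp only [h1, h2]
  have hz : (Real.sin p.1 : ℂ) ^ n ≠ 0 := zpow_ne_zero _ hs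
  rw [zpow_sub_one₀ hs, zpow_neg]
  push_cast at *
  field_simp
  ring

lemma aux_ethBar (n : ℤ) (g : ℝ × ℝ → ℂ) (p : ℝ × ℝ) (a b : ℂ)
    (hs : (Real.sin p.1 : ℂ) ≠ 0)
    (ha : HasDerivAt (fun t => g (t, p.2)) a p.1)
    (hb : HasDerivAt (fun t => g (p.1, t)) b p.2) :
    ethBar n g p = -(a - I / (Real.sin p.1 : ℂ) * b
      + n * (Real.cos p.1 : ℂ) / (Real.sin p.1 : ℂ) * g p) := by
  have h1 := ((aux_zpow n p.1 hs).mul ha).deriv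
  have h2 := (hb.const_mul ((Real.sin p.1 : ℂ) ^ n)).deriv
  unfold ethBar pdTheta pdPhi
  simp only [Pi.mul_def] at h1
  simp only [h1, h2]
  have hz : (Real.sin p.1 : ℂ) ^ n ≠ 0 := zpow_ne_zero _ hs
  rw [zpow_sub_one₀ hs, zpow_neg]
  push_cast at *
  field_simp
  ring

lemma aux_open : IsOpen sphDomain :=
  (isOpen_lt continuous_const continuous_fst).inter (isOpen_lt continuous_fst continuous_const)

lemma aux_sin (p : ℝ × ℝ) (hp : p ∈ sphDomain) : (Real.sin p.1 : ℂ) ≠ 0 := by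
  exact_mod_cast (Real.sin_pos_of_pos_of_lt_pi hp.1 hp.2).ne'

lemma aux_slice1 {g : ℝ × ℝ → ℂ} {p : ℝ × ℝ} (hg : DifferentiableAt ℝ g p) :
    HasDerivAt (fun t => g (t, p.2)) (fderiv ℝ g p (1, 0)) p.1 :=
  HasFDerivAt.comp_hasDerivAt (f := fun t : ℝ => (t, p.2)) p.1 hg.hasFDerivAt
    ((hasDerivAt_id p.1).prodMk (hasDerivAt_const p.1 p.2))

lemma aux_slice2 {g : ℝ × ℝ → ℂ} {p : ℝ × ℝ} (hg : DifferentiableAt ℝ g p) :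
    HasDerivAt (fun t => g (p.1, t)) (fderiv ℝ g p (0, 1)) p.2 :=
  HasFDerivAt.comp_hasDerivAt (f := fun t : ℝ => (p.1, t)) p.2 hg.hasFDerivAt
    ((hasDerivAt_const p.2 p.1).prodMk (hasDerivAt_id p.2))

/-- Slice derivatives of the first-order expression, for a constant `e = ±1` . -/
lemma aux_comb (c e : ℂ) (g f A B : ℝ × ℝ → ℂ) (p : ℝ × ℝ) (hp : p ∈ sphDomain)
    (hg : ∀ q ∈ sphDomain, g q = -(A q + e * (I / (Real.sin q.1 : ℂ) * B q)
      - e * (c * (Real.cos q.1 : ℂ) / (Real.sin q.1 : ℂ) * f q)))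
    {a1 a2 b1 b2 f1 f2 : ℂ}
    (hA1 : HasDerivAt (fun t => A (t, p.2)) a1 p.1) (hA2 : HasDerivAt (fun t => A (p.1, t)) a2 p.2)
    (hB1 : HasDerivAt (fun t => B (t, p.2)) b1 p.1) (hB2 : HasDerivAt (fun t => B (p.1, t)) b2 p.2)
    (hf1 : HasDerivAt (fun t => f (t, p.2)) f1 p.1)
    (hf2 : HasDerivAt (fun t => f (p.1, t)) f2 p.2) :
    HasDerivAt (fun t => g (t, p.2))
      (-(a1 + e * (I / (Real.sin p.1 : ℂ) * b1 - I * (Real.cos p.1 : ℂ) / (Real.sin p.1 : ℂ) ^ 2 * B p)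
      - e * (c * (Real.cos p.1 : ℂ) / (Real.sin p.1 : ℂ) * f1
        - c / (Real.sin p.1 : ℂ) ^ 2 * f p))) p.1 ∧
    HasDerivAt (fun t => g (p.1, t))
      (-(a2 + e * (I / (Real.sin p.1 : ℂ) * b2)
      - e * (c * (Real.cos p.1 : ℂ) / (Real.sin p.1 : ℂ) * f2))) p.2 := by
  have hs := aux_sin p hp
  have hU := aux_open.mem_nhds hp
  have hsd : HasDerivAt (fun t : ℝ => (Real.sin t : ℂ)) (Real.cos p.1 : ℂ) p.1 :=
    (Real.hasDerivAt_sin p.1).ofReal_comp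
  have hcd : HasDerivAt (fun t : ℝ => (Real.cos t : ℂ)) ((-Real.sin p.1 : ℝ) : ℂ) p.1 :=
    (Real.hasDerivAt_cos p.1).ofReal_comp
  have hsc : (Real.sin p.1 : ℂ) ^ 2 + (Real.cos p.1 : ℂ) ^ 2 = 1 := by
    exact_mod_cast Real.sin_sq_add_cos_sq p.1
  constructor
  · have hE : (fun t => g (t, p.2)) =ᶠ[nhds p.1] fun t =>
        -(A (t, p.2) + e * (I / (Real.sin t : ℂ) * B (t, p.2))
        - e * (c * (Real.cos t : ℂ) / (Real.sin t : ℂ) * f (t, p.2))) := by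
      have hc : ContinuousAt (fun t : ℝ => (t, p.2)) p.1 := by fun_prop
      filter_upwards [hc.preimage_mem_nhds hU] with t ht
      exact hg _ ht
    refine HasDerivAt.congr_of_eventuallyEq ?_ hE
    have h := ((hA1.add ((((hasDerivAt_const p.1 I).div hsd hs).mul hB1).const_mul e)).sub
      ((((hcd.const_mul c).div hsd hs).mul hf1).const_mul e)).neg
    refine h.congr_deriv ?_
    simp only [Pi.div_apply, ofReal_neg]
    generalize (Real.sin p.1 : ℂ) = s at *
    generalize (Real.cos p.1 : ℂ) = k at *
    field_simp
    linear_combination (-e * c * f p) * hsc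
  · have hE : (fun t => g (p.1, t)) =ᶠ[nhds p.2] fun t =>
        -(A (p.1, t) + e * (I / (Real.sin p.1 : ℂ) * B (p.1, t))
        - e * (c * (Real.cos p.1 : ℂ) / (Real.sin p.1 : ℂ) * f (p.1, t))) := by
      have hc : ContinuousAt (fun t : ℝ => (p.1, t)) p.2 := by fun_prop
      filter_upwards [hc.preimage_mem_nhds hU] with t ht
      exact hg _ ht
    refine HasDerivAt.congr_of_eventuallyEq ?_ hE
    exact ((hA2.add ((hB2.const_mul _).const_mul e)).sub ((hf2.const_mul _).const_mul e)).neg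

/-- The commutator `[ð̄, ð]` acts as multiplication by `2η` on smooth functions of
spin weight `η` on `U = {(θ,φ) : 0 < θ < π}`. -/
theorem ethBar_eth_commutator (η : ℤ) (f : ℝ × ℝ → ℂ)
    (hf : ContDiffOn ℝ (⊤ : ℕ∞) f sphDomain) :
    ∀ p ∈ sphDomain,
      ethBar (η + 1) (eth η f) p - eth (η - 1) (ethBar η f) p = 2 * (η : ℂ) * f p := by
  intro p hp
  have hat : ∀ q ∈ sphDomain, ContDiffAt ℝ (⊤ : ℕ∞) f q :=
    fun q hq => hf.contDiffAt (aux_open.mem_nhds hq)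
  have hd : ∀ q ∈ sphDomain, DifferentiableAt ℝ f q :=
    fun q hq => (hat q hq).differentiableAt (by simp)
  have h2 : (2 : WithTop ℕ∞) ≤ ((⊤ : ℕ∞) : WithTop ℕ∞) :=
    WithTop.coe_le_coe.2 (le_top : (2 : ℕ∞) ≤ ⊤)
  have hD : DifferentiableAt ℝ (fderiv ℝ f) p :=
    ((hat p hp).fderiv_right (m := 1) (by rw [one_add_one_eq_two]; exact h2)).differentiableAt (by simp)
  have hsym : IsSymmSndFDerivAt ℝ f p := (hat p hp).isSymmSndFDerivAt (by
    simp only [minSmoothness_of_isRCLikeNormedField]; exact h2)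
  have hv : ∀ v w : ℝ × ℝ, DifferentiableAt ℝ (fun q => fderiv ℝ f q v) p ∧
      fderiv ℝ (fun q => fderiv ℝ f q v) p w = fderiv ℝ (fderiv ℝ f) p w v := by
    intro v w
    have := hD.hasFDerivAt.clm_apply (hasFDerivAt_const v p)
    exact ⟨this.differentiableAt, by rw [this.fderiv]; simp⟩
  have hA1 := aux_slice1 (hv (1, 0) 0).1
  have hA2 := aux_slice2 (hv (1, 0) 0).1
  have hB1 := aux_slice1 (hv (0, 1) 0).1
  have hB2 := aux_slice2 (hv (0, 1) 0).1
  rw [(hv _ _).2] at hA1 hA2 hB1 hB2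
  rw [hsym.eq] at hA2
  have hs := aux_sin p hp
  have e1 : ∀ q ∈ sphDomain, eth η f q = -(fderiv ℝ f q (1, 0)
      + 1 * (I / (Real.sin q.1 : ℂ) * fderiv ℝ f q (0, 1))
      - 1 * ((η : ℂ) * (Real.cos q.1 : ℂ) / (Real.sin q.1 : ℂ) * f q)) := by
    intro q hq
    rw [aux_eth η f q _ _ (aux_sin q hq) (aux_slice1 (hd q hq)) (aux_slice2 (hd q hq))]
    ring
  have e2 : ∀ q ∈ sphDomain, ethBar η f q = -(fderiv ℝ f q (1, 0)
      + (-1) * (I / (Real.sin q.1 : ℂ) * fderiv ℝ f q (0, 1))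
      - (-1) * ((η : ℂ) * (Real.cos q.1 : ℂ) / (Real.sin q.1 : ℂ) * f q)) := by
    intro q hq
    rw [aux_ethBar η f q _ _ (aux_sin q hq) (aux_slice1 (hd q hq)) (aux_slice2 (hd q hq))]
    ring
  obtain ⟨c1, c2⟩ := aux_comb η 1 _ f _ _ p hp e1 hA1 hA2 hB1 hB2
    (aux_slice1 (hd p hp)) (aux_slice2 (hd p hp))
  obtain ⟨d1, d2⟩ := aux_comb η (-1) _ f _ _ p hp e2 hA1 hA2 hB1 hB2
    (aux_slice1 (hd p hp)) (aux_slice2 (hd p hp))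
  rw [aux_ethBar _ _ p _ _ hs c1 c2, aux_eth _ _ p _ _ hs d1 d2, e1 p hp, e2 p hp]
  have hsc : (Real.sin p.1 : ℂ) ^ 2 + (Real.cos p.1 : ℂ) ^ 2 = 1 := by
    exact_mod_cast Real.sin_sq_add_cos_sq p.1
  clear c1 c2 d1 d2 e1 e2
  simp only [Int.cast_add, Int.cast_sub, Int.cast_one]
  generalize (Real.sin p.1 : ℂ) = s at *
  generalize (Real.cos p.1 : ℂ) = k at *
  field_simp
  linear_combination (-2 * η * f p) * hsc
end

section
/- Fix a natural number j. Define γ(j,N) := √N · N! / √((N+j+1)!·(N−j)!) for natural numbers N ≥ j. Then lim_{N→∞} N·(γ(j,N) − exp(−j(j+1)/(2N))) = −1/2; in particular γ(j,N) = exp(−j(j+1)/(2N)) + O(1/N) as N → ∞, so with N = 2J the weight factor γ_j of a spin J satisfies γ_j = exp(−j(j+1)/(4J)) + O(J^{−1}). -/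
open Filter Topology

/-- The weight factor `γ(j,N) = √N·N!/√((N+j+1)!·(N−j)!)`. -/
noncomputable def gammaWeight (j N : ℕ) : ℝ :=
  Real.sqrt N * (Nat.factorial N : ℝ) /
    Real.sqrt ((Nat.factorial (N + j + 1) : ℝ) * (Nat.factorial (N - j) : ℝ))

noncomputable def auxF : ℕ → ℝ → ℝ
  | 0, x => 1 / (1 + x)
  | (j + 1), x => auxF j x * ((1 - (j : ℝ) * x) / (1 + ((j : ℝ) + 2) * x))

lemma auxF_zero (j : ℕ) : auxF j 0 = 1 := by
  induction j with
  | zero => simp [auxF]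
  | succ j ih => simp [auxF, ih]

lemma auxF_deriv (j : ℕ) : HasDerivAt (auxF j) (-((j : ℝ) ^ 2 + j + 1)) 0 := by
  induction j with
  | zero =>
    have h : HasDerivAt (fun x : ℝ => 1 / (1 + x)) ((0 * (1 + 0) - 1 * 1) / (1 + 0) ^ 2) (0 : ℝ) :=
      (hasDerivAt_const (0 : ℝ) (1 : ℝ)).div ((hasDerivAt_id (0 : ℝ)).const_add 1) (by norm_num)
    have e : auxF 0 = fun x : ℝ => 1 / (1 + x) := by funext x; simp [auxF]
    rw [e]
    convert h using 1
    norm_num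
  | succ j ih =>
    have h1 : HasDerivAt (fun x : ℝ => 1 - (j : ℝ) * x) (-((j : ℝ) * 1)) (0 : ℝ) :=
      ((hasDerivAt_id (0 : ℝ)).const_mul (j : ℝ)).const_sub 1
    have h2 : HasDerivAt (fun x : ℝ => 1 + ((j : ℝ) + 2) * x) (((j : ℝ) + 2) * 1) (0 : ℝ) :=
      ((hasDerivAt_id (0 : ℝ)).const_mul ((j : ℝ) + 2)).const_add 1
    have h := ih.mul (h1.div h2 (by norm_num))
    have e : auxF (j + 1) =
      auxF j * ((fun x : ℝ => 1 - (j : ℝ) * x) / (fun x : ℝ => 1 + ((j : ℝ) + 2) * x)) := by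
      funext x; simp [auxF]
    rw [e]
    refine h.congr_deriv ?_
    simp [auxF_zero]
    ring

lemma gamma_sq (j N : ℕ) (hN : 0 < N) (h : j ≤ N) :
    (N : ℝ) * (Nat.factorial N : ℝ) ^ 2 /
      ((Nat.factorial (N + j + 1) : ℝ) * (Nat.factorial (N - j) : ℝ)) = auxF j ((N : ℝ)⁻¹) := by
  have hN' : (N : ℝ) ≠ 0 := by positivity
  induction j with
  | zero =>
    have hf : (Nat.factorial N : ℝ) ≠ 0 := by positivity
    have h1 : (N : ℝ) + 1 ≠ 0 := by positivity
    simp only [auxF, Nat.add_zero, Nat.sub_zero, Nat.factorial_succ]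
    push_cast
    field_simp
  | succ j ih =>
    obtain ⟨m, rfl⟩ := Nat.exists_eq_add_of_le h
    have ih' := ih (by omega)
    simp only [auxF]
    rw [← ih']
    have e1 : j + 1 + m - (j + 1) = m := by omega
    have e2 : j + 1 + m - j = m + 1 := by omega
    have e3 : j + 1 + m + (j + 1) + 1 = (j + 1 + m + j + 1) + 1 := by omega
    rw [e1, e2, e3, Nat.factorial_succ (j + 1 + m + j + 1), Nat.factorial_succ m]
    have hA : (Nat.factorial (j + 1 + m + j + 1) : ℝ) ≠ 0 := by positivity
    have hB : (Nat.factorial m : ℝ) ≠ 0 := by positivity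
    have e4 : (1 - (j : ℝ) * ((j + 1 + m : ℕ) : ℝ)⁻¹) / (1 + ((j : ℝ) + 2) * ((j + 1 + m : ℕ) : ℝ)⁻¹)
        = ((m : ℝ) + 1) / ((j : ℝ) + 1 + m + j + 2) := by
      have : ((j : ℝ) + 1 + m + j + 2) ≠ 0 := by positivity
      have h3 : (1 + ((j : ℝ) + 2) * ((j + 1 + m : ℕ) : ℝ)⁻¹) ≠ 0 := by positivity
      rw [div_eq_div_iff h3 this]
      push_cast at hN' ⊢
      field_simp
      ring
    rw [e4]
    push_cast
    have h5 : (j : ℝ) + 1 + m + j + 2 ≠ 0 := by positivity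
    have h6 : (j : ℝ) + 1 + m + j + 1 + 1 ≠ 0 := by positivity
    have h7 : (m : ℝ) + 1 ≠ 0 := by positivity
    rw [div_mul_div_comm, div_eq_div_iff (by positivity) (by positivity)]
    ring

lemma gammaWeight_eq (j N : ℕ) (hN : 0 < N) (h : j ≤ N) :
    gammaWeight j N = Real.sqrt (auxF j ((N : ℝ)⁻¹)) := by
  rw [← gamma_sq j N hN h, Real.sqrt_div (by positivity), Real.sqrt_mul (by positivity),
    Real.sqrt_sq (by positivity)]
  rfl

/-- Gaussian approximation of the weight factor:
`lim_{N→∞} N·(γ(j,N) − exp(−j(j+1)/(2N))) = −1/2`, so with `N = 2J` the weight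
factor of a spin `J` satisfies `γ_j = exp(−j(j+1)/(4J)) + O(J^{−1})`. -/
theorem gammaWeight_asymptotic (j : ℕ) :
    Tendsto
      (fun N : ℕ =>
        (N : ℝ) * (gammaWeight j N - Real.exp (-((j : ℝ) * ((j : ℝ) + 1)) / (2 * (N : ℝ)))))
      atTop (𝓝 (-(1 / 2))) := by
  have hs := (auxF_deriv j).sqrt (by rw [auxF_zero]; norm_num)
  have he : HasDerivAt (fun x : ℝ => Real.exp (-((j : ℝ) * ((j : ℝ) + 1)) / 2 * x))
      (Real.exp (-((j : ℝ) * ((j : ℝ) + 1)) / 2 * 0) * (-((j : ℝ) * ((j : ℝ) + 1)) / 2 * 1))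
      (0 : ℝ) := ((hasDerivAt_id (0 : ℝ)).const_mul (-((j : ℝ) * ((j : ℝ) + 1)) / 2)).exp
  have hd := (hs.sub he).tendsto_slope_zero
  have hx : Tendsto (fun N : ℕ => ((N : ℝ)⁻¹)) atTop (𝓝[≠] 0) := by
    rw [tendsto_nhdsWithin_iff]
    refine ⟨tendsto_inv_atTop_nhds_zero_nat, ?_⟩
    filter_upwards [eventually_gt_atTop 0] with N hN
    simp; omega
  have := hd.comp hx
  have ev : -(1 / 2 : ℝ) = -((j : ℝ) ^ 2 + j + 1) / (2 * Real.sqrt (auxF j 0)) -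
      Real.exp (-((j : ℝ) * ((j : ℝ) + 1)) / 2 * 0) * (-((j : ℝ) * ((j : ℝ) + 1)) / 2 * 1) := by
    simp [auxF_zero]
    ring
  rw [ev]
  refine this.congr' ?_
  filter_upwards [eventually_gt_atTop 0, eventually_ge_atTop j] with N hN hj
  rw [gammaWeight_eq j N hN hj]
  have e5 : -((j : ℝ) * ((j : ℝ) + 1)) / (2 * (N : ℝ)) =
      -((j : ℝ) * ((j : ℝ) + 1)) / 2 * (N : ℝ)⁻¹ := by
    rw [← div_div, div_eq_mul_inv _ (N : ℝ)]
  rw [e5]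
  simp [auxF_zero]
end

section
/- For every fixed natural number η, lim_{j→∞} j·(j^η · √((j−η)!/(j+η)!) − 1) = −η/2, the limit taken over natural numbers j ≥ η; equivalently √((j−η)!/(j+η)!) = j^{−η}·(1 − η/(2j) + O(j^{−2})) as j → ∞. -/
open Filter Topology

theorem aux_exists (η : ℕ) : ∃ Φ : ℝ → ℝ, HasDerivAt Φ (-(η : ℝ) / 2) 0 ∧ Φ 0 = 1 ∧
    ∀ j : ℕ, η < j → (j : ℝ) ^ η *
      Real.sqrt ((Nat.factorial (j - η) : ℝ) / (Nat.factorial (j + η) : ℝ)) = Φ ((j : ℝ)⁻¹) := by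
  induction η with
  | zero =>
    refine ⟨fun _ => 1, ?_, rfl, ?_⟩
    · simpa using hasDerivAt_const (0 : ℝ) (1 : ℝ)
    · intro j _
      have : (Nat.factorial j : ℝ) ≠ 0 := by positivity
      simp [this]
  | succ n ih =>
    obtain ⟨Φ, hd, h0, he⟩ := ih
    refine ⟨fun x => Φ x * (Real.sqrt ((1 - n * x) * (1 + (n + 1) * x)))⁻¹, ?_, by simp [h0], ?_⟩
    · have h1 : HasDerivAt (fun x : ℝ => (1 - n * x) * (1 + (n + 1) * x)) 1 0 := by
        have a : HasDerivAt (fun x : ℝ => 1 - (n : ℝ) * x) (-((n : ℝ) * 1)) 0 :=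
          ((hasDerivAt_id (0 : ℝ)).const_mul (n : ℝ)).const_sub 1
        have b : HasDerivAt (fun x : ℝ => 1 + ((n : ℝ) + 1) * x) (((n : ℝ) + 1) * 1) 0 :=
          ((hasDerivAt_id (0 : ℝ)).const_mul ((n : ℝ) + 1)).const_add 1
        have c := a.mul b
        refine HasDerivAt.congr_deriv c ?_
        simp
      have h2 := (h1.sqrt (by simp)).inv (by simp)
      have h3 := hd.mul h2
      refine HasDerivAt.congr_deriv h3 ?_
      simp [h0]
      ring
    · intro j hj
      have hj0 : (0 : ℝ) < j := by exact_mod_cast (by omega : 0 < j)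
      have hjn : (0 : ℝ) < (j : ℝ) - n := by
        have : (n : ℝ) < j := by exact_mod_cast (by omega : n < j)
        linarith
      have e := he j (by omega)
      simp only
      rw [← e]
      obtain ⟨k, rfl⟩ : ∃ k, j = k + (n + 1) := ⟨j - (n + 1), by omega⟩
      have s1 : k + (n + 1) - (n + 1) = k := by omega
      have s2 : k + (n + 1) - n = k + 1 := by omega
      have s3 : k + (n + 1) + (n + 1) = (k + (n + 1) + n) + 1 := by omega
      rw [s1, s2, s3, Nat.factorial_succ k, Nat.factorial_succ (k + (n + 1) + n), pow_succ, mul_assoc,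
        mul_assoc]
      congr 1
      rw [← Real.sqrt_inv, ← Real.sqrt_mul (by positivity)]
      conv_lhs => rw [← Real.sqrt_sq hj0.le]
      rw [← Real.sqrt_mul (by positivity)]
      congr 1
      have f1 : (Nat.factorial k : ℝ) ≠ 0 := by positivity
      have f2 : (Nat.factorial (k + (n + 1) + n) : ℝ) ≠ 0 := by positivity
      have f3 : (1 - (n : ℝ) * ((k + (n + 1) : ℕ) : ℝ)⁻¹) * (1 + (n + 1) * ((k + (n + 1) : ℕ) : ℝ)⁻¹)
          = ((k : ℝ) + 1) * (k + (n + 1) + n + 1) / ((k + (n + 1) : ℕ) : ℝ) ^ 2 := by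
        field_simp
        push_cast
        ring
      rw [f3]
      have g1 : (k : ℝ) + 1 ≠ 0 := by positivity
      have g2 : (k : ℝ) + (n + 1) + n + 1 ≠ 0 := by positivity
      push_cast
      field_simp

/-- Asymptotics of the spin-weighted spherical-harmonics normalization prefactor:
`lim_{j→∞} j·(j^η·√((j−η)!/(j+η)!) − 1) = −η/2`, i.e.
`√((j−η)!/(j+η)!) = j^{−η}(1 − η/(2j) + O(j^{−2}))`. -/
theorem sqrt_factorial_ratio_asymptotic (η : ℕ) :
    Tendsto
      (fun j : ℕ =>
        (j : ℝ) *
          ((j : ℝ) ^ η *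
              Real.sqrt ((Nat.factorial (j - η) : ℝ) / (Nat.factorial (j + η) : ℝ)) - 1))
      atTop (𝓝 (-(η : ℝ) / 2)) := by
  obtain ⟨Φ, hd, h0, he⟩ := aux_exists η
  have h1 := hasDerivAt_iff_tendsto_slope_zero.1 hd
  have h2 : Tendsto (fun j : ℕ => ((j : ℝ))⁻¹) atTop (𝓝[≠] 0) := by
    refine tendsto_nhdsWithin_iff.2 ⟨tendsto_inv_atTop_nhds_zero_nat, ?_⟩
    filter_upwards [eventually_gt_atTop 0] with j hj
    have : (j : ℝ) ≠ 0 := by exact_mod_cast hj.ne'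
    simpa using hj.ne'
  refine (h1.comp h2).congr' ?_
  filter_upwards [eventually_gt_atTop η] with j hj
  rw [he j hj]
  simp [h0]
end

section
/- Let F : (0,∞) × ℝ → ℂ be smooth, fix r > 0 and φ ∈ ℝ, and for a > 0 define f_a(θ,φ) := F(aθ, φ). Then lim_{a→∞} (1/(4a²))·(ð̄_1(ð_0 f_a))(r/a, φ) = (1/4)·(∂²_r F + (1/r)∂_r F + (1/r²)∂²_φ F)(r,φ), with error O(a^{−2}); the limiting operator (1/4)(∂²_r + (1/r)∂_r + (1/r²)∂²_φ) is the polar-coordinate form of the product of Wirtinger derivatives ∂_{α*}∂_α. -/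
open Complex

open Filter Topology Asymptotics


def rPos : Set (ℝ × ℝ) := {p : ℝ × ℝ | 0 < p.1}

lemma rPos_open : IsOpen rPos := isOpen_lt continuous_const continuous_fst

lemma hasD1 {G : ℝ × ℝ → ℂ} {p : ℝ × ℝ} (h : DifferentiableAt ℝ G p) :
    HasDerivAt (fun t => G (t, p.2)) (fderiv ℝ G p (1, 0)) p.1 := by
  have h1 : HasDerivAt (fun t : ℝ => (t, p.2)) ((1 : ℝ), (0 : ℝ)) p.1 :=
    (hasDerivAt_id p.1).prodMk (hasDerivAt_const _ _)
  exact HasFDerivAt.comp_hasDerivAt (x := p.1) (f := fun t : ℝ => (t, p.2)) h.hasFDerivAt h1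

lemma hasD2 {G : ℝ × ℝ → ℂ} {p : ℝ × ℝ} (h : DifferentiableAt ℝ G p) :
    HasDerivAt (fun t => G (p.1, t)) (fderiv ℝ G p (0, 1)) p.2 := by
  have h1 : HasDerivAt (fun t : ℝ => (p.1, t)) ((0 : ℝ), (1 : ℝ)) p.2 :=
    (hasDerivAt_const _ _).prodMk (hasDerivAt_id p.2)
  exact HasFDerivAt.comp_hasDerivAt (x := p.2) (f := fun t : ℝ => (p.1, t)) h.hasFDerivAt h1

lemma smooth_diff {G : ℝ × ℝ → ℂ} (hG : ContDiffOn ℝ (⊤ : ℕ∞) G rPos) {p : ℝ × ℝ}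
    (hp : p ∈ rPos) : DifferentiableAt ℝ G p :=
  (hG.contDiffAt (rPos_open.mem_nhds hp)).differentiableAt (by simp)

lemma pdTheta_eq {G : ℝ × ℝ → ℂ} (hG : ContDiffOn ℝ (⊤ : ℕ∞) G rPos) {p : ℝ × ℝ}
    (hp : p ∈ rPos) : pdTheta G p = fderiv ℝ G p (1, 0) :=
  (hasD1 (smooth_diff hG hp)).deriv

lemma pdPhi_eq {G : ℝ × ℝ → ℂ} (hG : ContDiffOn ℝ (⊤ : ℕ∞) G rPos) {p : ℝ × ℝ}
    (hp : p ∈ rPos) : pdPhi G p = fderiv ℝ G p (0, 1) :=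
  (hasD2 (smooth_diff hG hp)).deriv

lemma smooth_fd {G : ℝ × ℝ → ℂ} (hG : ContDiffOn ℝ (⊤ : ℕ∞) G rPos) :
    ContDiffOn ℝ (⊤ : ℕ∞) (fderiv ℝ G) rPos :=
  hG.fderiv_of_isOpen rPos_open (by simp)

lemma smooth1 {G : ℝ × ℝ → ℂ} (hG : ContDiffOn ℝ (⊤ : ℕ∞) G rPos) :
    ContDiffOn ℝ (⊤ : ℕ∞) (pdTheta G) rPos :=
  ((smooth_fd hG).clm_apply contDiffOn_const).congr fun _ hp => pdTheta_eq hG hp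

lemma smooth2 {G : ℝ × ℝ → ℂ} (hG : ContDiffOn ℝ (⊤ : ℕ∞) G rPos) :
    ContDiffOn ℝ (⊤ : ℕ∞) (pdPhi G) rPos :=
  ((smooth_fd hG).clm_apply contDiffOn_const).congr fun _ hp => pdPhi_eq hG hp

lemma mixed {G : ℝ × ℝ → ℂ} (hG : ContDiffOn ℝ (⊤ : ℕ∞) G rPos) {p : ℝ × ℝ}
    (hp : p ∈ rPos) : pdTheta (pdPhi G) p = pdPhi (pdTheta G) p := by
  have hn := rPos_open.mem_nhds hp
  have hd : DifferentiableAt ℝ (fderiv ℝ G) p :=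
    ((smooth_fd hG).contDiffAt hn).differentiableAt (by simp)
  have key : ∀ v : ℝ × ℝ, fderiv ℝ (fun q => fderiv ℝ G q v) p = (fderiv ℝ (fderiv ℝ G) p).flip v := by
    intro v
    ext <;> simp [fderiv_clm_apply hd (differentiableAt_const v)]
  rw [pdTheta_eq (smooth2 hG) hp, pdPhi_eq (smooth1 hG) hp]
  have e1 : pdPhi G =ᶠ[𝓝 p] fun q => fderiv ℝ G q (0, 1) := by
    filter_upwards [hn] with q hq using pdPhi_eq hG hq
  have e2 : pdTheta G =ᶠ[𝓝 p] fun q => fderiv ℝ G q (1, 0) := by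
    filter_upwards [hn] with q hq using pdTheta_eq hG hq
  rw [e1.fderiv_eq, e2.fderiv_eq, key, key]
  have hs : IsSymmSndFDerivAt ℝ G p :=
    (hG.contDiffAt hn).isSymmSndFDerivAt (by
      simp only [minSmoothness_of_isRCLikeNormedField]
      exact WithTop.coe_le_coe.2 (le_top : (2 : ℕ∞) ≤ ⊤))
  exact hs _ _

lemma D1 {G : ℝ × ℝ → ℂ} (hG : ContDiffOn ℝ (⊤ : ℕ∞) G rPos) {x y : ℝ}
    (hx : 0 < x) : HasDerivAt (fun t => G (t, y)) (pdTheta G (x, y)) x := by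
  rw [pdTheta_eq hG (p := (x, y)) hx]
  exact hasD1 (p := (x, y)) (smooth_diff hG hx)

lemma D2 {G : ℝ × ℝ → ℂ} (hG : ContDiffOn ℝ (⊤ : ℕ∞) G rPos) {x y : ℝ}
    (hx : 0 < x) : HasDerivAt (fun t => G (x, t)) (pdPhi G (x, y)) y := by
  rw [pdPhi_eq hG (p := (x, y)) hx]
  exact hasD2 (p := (x, y)) (smooth_diff hG hx)

lemma D1s {G : ℝ × ℝ → ℂ} (hG : ContDiffOn ℝ (⊤ : ℕ∞) G rPos) {a x y : ℝ}
    (hx : 0 < a * x) :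
    HasDerivAt (fun t : ℝ => G (a * t, y)) ((a : ℂ) * pdTheta G (a * x, y)) x := by
  have h := (D1 hG (y := y) hx).scomp x ((hasDerivAt_id x).const_mul a)
  have e : (a * 1) • pdTheta G (a * x, y) = (a : ℂ) * pdTheta G (a * x, y) := by simp
  exact e ▸ h

lemma eth_form {F : ℝ × ℝ → ℂ} (hF : ContDiffOn ℝ (⊤ : ℕ∞) F rPos) {a x y : ℝ}
    (hx : 0 < a * x) (hs : Real.sin x ≠ 0) :
    (Real.sin x : ℂ) * eth 0 (fun p => F (a * p.1, p.2)) (x, y) =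
      -((a : ℂ) * (Real.sin x : ℂ) * pdTheta F (a * x, y) + I * pdPhi F (a * x, y)) := by
  have hs' : (Real.sin x : ℂ) ≠ 0 := by exact_mod_cast hs
  have h1 := (D1s hF (y := y) hx).deriv
  have h2 := (D2 hF (y := y) hx).deriv
  simp only [eth, pdTheta, pdPhi, neg_zero, zpow_zero, one_mul]
  simp only [pdTheta, pdPhi] at h1 h2
  rw [h1]
  field_simp

lemma ethBar_form {F : ℝ × ℝ → ℂ} (hF : ContDiffOn ℝ (⊤ : ℕ∞) F rPos) {a x y : ℝ}
    (ha : 0 < a) (hx : 0 < x) (hxpi : x < Real.pi) :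
    ethBar 1 (eth 0 (fun p => F (a * p.1, p.2))) (x, y) =
      (a : ℂ) ^ 2 * pdTheta (pdTheta F) (a * x, y)
        + a * Real.cos x / Real.sin x * pdTheta F (a * x, y)
        + pdPhi (pdPhi F) (a * x, y) / (Real.sin x : ℂ) ^ 2 := by
  have hax : 0 < a * x := by positivity
  have hs : Real.sin x ≠ 0 := (Real.sin_pos_of_pos_of_lt_pi hx hxpi).ne'
  have hs' : (Real.sin x : ℂ) ≠ 0 := by exact_mod_cast hs
  have e1 : (fun t : ℝ => (Real.sin t : ℂ) * eth 0 (fun p => F (a * p.1, p.2)) (t, y)) =ᶠ[𝓝 x]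
      fun t => -((a : ℂ) * (Real.sin t : ℂ) * pdTheta F (a * t, y) + I * pdPhi F (a * t, y)) := by
    filter_upwards [Ioo_mem_nhds hx hxpi] with t ht
    exact eth_form hF (mul_pos ha ht.1) (Real.sin_pos_of_pos_of_lt_pi ht.1 ht.2).ne'
  have e2 : (fun t : ℝ => (Real.sin x : ℂ) * eth 0 (fun p => F (a * p.1, p.2)) (x, t)) =
      fun t => -((a : ℂ) * (Real.sin x : ℂ) * pdTheta F (a * x, t) + I * pdPhi F (a * x, t)) := by
    funext t
    exact eth_form hF hax hs
  have hsin : HasDerivAt (fun t : ℝ => (Real.sin t : ℂ)) (Real.cos x : ℂ) x :=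
    (Real.hasDerivAt_sin x).ofReal_comp
  have d1 := (((hsin.const_mul (a : ℂ)).mul (D1s (smooth1 hF) (y := y) hax)).add
    ((D1s (smooth2 hF) (y := y) hax).const_mul I)).neg.deriv
  have d2 := (((D2 (smooth1 hF) (y := y) hax).const_mul ((a : ℂ) * (Real.sin x : ℂ))).add
    ((D2 (smooth2 hF) (y := y) hax).const_mul I)).neg.deriv
  have E1 := e1.deriv_eq.trans d1
  have E2 := (congrArg (fun f => deriv f y) e2).trans d2
  have : ethBar 1 (eth 0 (fun p => F (a * p.1, p.2))) (x, y) =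
    -((Real.sin x : ℂ) ^ (-1 : ℤ)) *
      (deriv (fun t : ℝ => (Real.sin t : ℂ) * eth 0 (fun p => F (a * p.1, p.2)) (t, y)) x -
        (Complex.I / (Real.sin x : ℂ)) *
          deriv (fun t : ℝ => (Real.sin x : ℂ) * eth 0 (fun p => F (a * p.1, p.2)) (x, t)) y) := by
    simp only [ethBar, zpow_one]
    rfl
  rw [this, E1, E2, mixed hF (p := (a * x, y)) hax, zpow_neg_one]
  generalize (Real.sin x : ℂ) = s at *
  generalize (Real.cos x : ℂ) = c at *
  field_simp
  ring_nf
  simp only [I_sq]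
  ring

lemma bd1 {x : ℝ} (hx : 0 < x) (hx1 : x ≤ 1) :
    |x * Real.cos x / Real.sin x - 1| ≤ x ^ 2 := by
  have h1 := Real.sin_gt_sub_cube hx
  have h2 := Real.sin_lt hx
  have h3 := Real.one_sub_sq_div_two_le_cos (x := x)
  have h4 := Real.cos_le_one x
  have hx2 : x ^ 2 ≤ 1 := by nlinarith
  have hl : x - x ^ 3 / 4 < Real.sin x := by linarith [pow_pos hx 3]
  have hs : 0 < Real.sin x := by nlinarith
  rw [div_sub_one hs.ne', abs_div, abs_of_pos hs, div_le_iff₀ hs, abs_le]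
  constructor
  · have : x * (1 - x ^ 2 / 2) ≤ x * Real.cos x := by gcongr
    nlinarith [pow_pos hx 2, pow_pos hx 3, pow_pos hx 5]
  · have : x * Real.cos x ≤ x := by nlinarith
    have h5 : (1 + x ^ 2) * (x - x ^ 3 / 4) ≤ (1 + x ^ 2) * Real.sin x := by gcongr
    have : 0 ≤ x ^ 3 * (1 - x ^ 2) := by
      apply mul_nonneg (by positivity); linarith
    nlinarith [pow_pos hx 3]

lemma bd2 {x : ℝ} (hx : 0 < x) (hx1 : x ≤ 1) :
    |x ^ 2 / Real.sin x ^ 2 - 1| ≤ x ^ 2 := by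
  have h1 := Real.sin_gt_sub_cube hx
  have h2 := Real.sin_lt hx
  have hx2 : x ^ 2 ≤ 1 := by nlinarith
  have hl : x - x ^ 3 / 4 < Real.sin x := by linarith [pow_pos hx 3]
  have hp : 0 ≤ x - x ^ 3 / 4 := by nlinarith
  have hs : 0 < Real.sin x := by linarith
  have hs2 : 0 < Real.sin x ^ 2 := by positivity
  rw [div_sub_one hs2.ne', abs_div, abs_of_pos hs2, div_le_iff₀ hs2]
  have h6 : Real.sin x ^ 2 ≤ x ^ 2 := by gcongr
  have h7 : (1 + x ^ 2) * (x - x ^ 3 / 4) ^ 2 ≤ (1 + x ^ 2) * Real.sin x ^ 2 := by gcongr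
  rw [abs_of_nonneg (by linarith)]
  have : 0 ≤ x ^ 4 * (1 / 2 - 7 / 16 * x ^ 2 + x ^ 4 / 16) := by
    apply mul_nonneg (by positivity); nlinarith [sq_nonneg (x^2)]
  nlinarith


/-- In the arc-length parametrization, the rescaled second-order operator
`ð̄ð/(4a²)` converges (with error `O(a^{−2})`) to the polar-coordinate form
`(1/4)(∂²_r + (1/r)∂_r + (1/r²)∂²_φ)` of the product of Wirtinger derivatives
`∂_{α*}∂_α`. -/
theorem rescaled_ethBar_eth_limit (F : ℝ × ℝ → ℂ)
    (hF : ContDiffOn ℝ (⊤ : ℕ∞) F {p : ℝ × ℝ | 0 < p.1})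
    (r φ : ℝ) (hr : 0 < r) :
    Tendsto
      (fun a : ℝ =>
        (1 / (4 * (a : ℂ) ^ 2)) * ethBar 1 (eth 0 (fun p => F (a * p.1, p.2))) (r / a, φ))
      atTop
      (𝓝 ((1 / 4 : ℂ) *
        (pdTheta (pdTheta F) (r, φ) + (1 / (r : ℂ)) * pdTheta F (r, φ) +
          (1 / (r : ℂ) ^ 2) * pdPhi (pdPhi F) (r, φ)))) ∧
    (fun a : ℝ =>
        (1 / (4 * (a : ℂ) ^ 2)) * ethBar 1 (eth 0 (fun p => F (a * p.1, p.2))) (r / a, φ) -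
          (1 / 4 : ℂ) *
            (pdTheta (pdTheta F) (r, φ) + (1 / (r : ℂ)) * pdTheta F (r, φ) +
              (1 / (r : ℂ) ^ 2) * pdPhi (pdPhi F) (r, φ)))
      =O[atTop] (fun a : ℝ => (a ^ 2)⁻¹) := by
  have hF' : ContDiffOn ℝ (⊤ : ℕ∞) F rPos := hF
  have hO : (fun a : ℝ =>
        (1 / (4 * (a : ℂ) ^ 2)) * ethBar 1 (eth 0 (fun p => F (a * p.1, p.2))) (r / a, φ) -
          (1 / 4 : ℂ) *
            (pdTheta (pdTheta F) (r, φ) + (1 / (r : ℂ)) * pdTheta F (r, φ) +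
              (1 / (r : ℂ) ^ 2) * pdPhi (pdPhi F) (r, φ)))
      =O[atTop] (fun a : ℝ => (a ^ 2)⁻¹) := by
    set A := pdTheta F (r, φ) with hA
    set B := pdPhi (pdPhi F) (r, φ) with hB
    refine IsBigO.of_bound (‖1 / 4 * (1 / (r : ℂ)) * A‖ * r ^ 2 +
      ‖1 / 4 * (1 / (r : ℂ) ^ 2) * B‖ * r ^ 2) ?_
    filter_upwards [eventually_ge_atTop r, eventually_gt_atTop 0] with a har ha
    have hx : 0 < r / a := by positivity
    have hx1 : r / a ≤ 1 := (div_le_one ha).2 har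
    have hpi : r / a < Real.pi := by linarith [Real.pi_gt_three]
    have hs : (Real.sin (r / a) : ℂ) ≠ 0 := by
      exact_mod_cast (Real.sin_pos_of_pos_of_lt_pi hx hpi).ne'
    have har' : a * (r / a) = r := by field_simp
    have hac : (a : ℂ) ≠ 0 := by exact_mod_cast ha.ne'
    have hrc : (r : ℂ) ≠ 0 := by exact_mod_cast hr.ne'
    rw [ethBar_form hF' ha hx hpi, har', ← hA, ← hB]
    have b1 := bd1 hx hx1
    have b2 := bd2 hx hx1
    have key : (1 / (4 * (a : ℂ) ^ 2)) * ((a : ℂ) ^ 2 * pdTheta (pdTheta F) (r, φ)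
        + a * Real.cos (r / a) / Real.sin (r / a) * A
        + B / (Real.sin (r / a) : ℂ) ^ 2) -
          (1 / 4 : ℂ) * (pdTheta (pdTheta F) (r, φ) + (1 / (r : ℂ)) * A + (1 / (r : ℂ) ^ 2) * B)
        = (1 / 4 * (1 / (r : ℂ)) * A) *
            ((r / a * Real.cos (r / a) / Real.sin (r / a) - 1 : ℝ) : ℂ) +
          (1 / 4 * (1 / (r : ℂ) ^ 2) * B) *
            (((r / a) ^ 2 / Real.sin (r / a) ^ 2 - 1 : ℝ) : ℂ) := by
      rw [Complex.ofReal_sub, Complex.ofReal_sub, Complex.ofReal_div, Complex.ofReal_div,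
        Complex.ofReal_mul, Complex.ofReal_pow, Complex.ofReal_pow, Complex.ofReal_div,
        Complex.ofReal_one]
      generalize (Real.sin (r / a) : ℂ) = s at *
      generalize (Real.cos (r / a) : ℂ) = c at *
      field_simp
      ring
    rw [key]
    refine (norm_add_le _ _).trans ?_
    rw [norm_mul, norm_mul _ (((r / a) ^ 2 / Real.sin (r / a) ^ 2 - 1 : ℝ) : ℂ),
      Complex.norm_real, Complex.norm_real, Real.norm_eq_abs, Real.norm_eq_abs,
      Real.norm_of_nonneg (by positivity : (0 : ℝ) ≤ (a ^ 2)⁻¹), add_mul,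
      mul_assoc ‖1 / 4 * (1 / (r : ℂ)) * A‖, mul_assoc ‖1 / 4 * (1 / (r : ℂ) ^ 2) * B‖]
    have : r ^ 2 * (a ^ 2)⁻¹ = (r / a) ^ 2 := by rw [div_pow, div_eq_mul_inv]
    rw [this]
    gcongr
  refine ⟨?_, hO⟩
  rw [← tendsto_sub_nhds_zero_iff]
  exact hO.trans_tendsto (tendsto_inv_atTop_zero.comp (tendsto_pow_atTop two_ne_zero))
end
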